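/- Let p be a prime number, K a perfect field of characteristic p, d a positive integer, and let s and H be positive integers. Let f ∈ K[[t_1,…,t_d]] and suppose there exist polynomials P_0,…,P_s ∈ K[t_1,…,t_d], each of total degree at most H, with P_s ≠ 0 and Σ_{i=0}^s P_i f^i = 0 in K[[t_1,…,t_d]] (i.e., f is algebraic of degree at most s and height at most H). Then there exist polynomials Q_0,…,Q_s ∈ K[t_1,…,t_d], each of total degree at most H·s·p^s, such that Σ_{i=0}^s Q_i f^{p^i} = 0 in K[[t_1,…,t_d]] and Q_0 ≠ 0. -/

import Mathlib

namespace MvPolynomial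

variable {σ R : Type*}

theorem totalDegree_det_le [CommRing R] {n : ℕ} (A : Matrix (Fin n) (Fin n) (MvPolynomial σ R))
    (e : Fin n → ℕ) (hA : ∀ i j, (A i j).totalDegree ≤ e j) :
    A.det.totalDegree ≤ ∑ j, e j := by
  rw [Matrix.det_apply]
  refine totalDegree_finsetSum_le fun τ _ => ?_
  have hprod : (∏ i, A (τ i) i).totalDegree ≤ ∑ j, e j :=
    (totalDegree_finsetProd _ _).trans (Finset.sum_le_sum fun i _ => hA _ _)
  rcases Int.units_eq_one_or (Equiv.Perm.sign τ) with h | h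
  · simpa [h] using hprod
  · simpa [h, totalDegree_neg] using hprod

/-- A homogeneous linear system of `n` equations in `n + 1` unknowns over a polynomial ring has a
nonzero solution whose degrees are bounded as in Cramer's rule. -/
theorem exists_mulVec_eq_zero_totalDegree_le [CommRing R] [IsDomain R] :
    ∀ (n : ℕ) (M : Matrix (Fin n) (Fin (n + 1)) (MvPolynomial σ R)) (e : Fin (n + 1) → ℕ),
      (∀ i j, (M i j).totalDegree ≤ e j) →
      ∃ v : Fin (n + 1) → MvPolynomial σ R, v ≠ 0 ∧ (∀ i, ∑ j, M i j * v j = 0) ∧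
        ∀ j, (v j).totalDegree + e j ≤ ∑ i, e i := by
  intro n
  induction n with
  | zero => exact fun M e _ => ⟨1, one_ne_zero, fun i => i.elim0, fun j => by simp [Fin.eq_zero j]⟩
  | succ n ih =>
    intro M e hM
    by_cases hdet : (M.submatrix id Fin.castSucc).det = 0
    · obtain ⟨w, hw, hwM⟩ := Matrix.exists_vecMul_eq_zero_iff.2 hdet
      obtain ⟨k, hk⟩ := Function.ne_iff.1 hw
      obtain ⟨v, hv, hMv, hdeg⟩ := ih (M.submatrix k.succAbove Fin.castSucc)
        (fun j => e j.castSucc) fun i j => hM _ _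
      simp only [Matrix.submatrix_apply] at hMv
      have hkv : ∑ j, M k j.castSucc * v j = 0 := by
        have hsum : ∑ i, w i * ∑ j, M i (Fin.castSucc j) * v j = 0 := by
          simp_rw [Finset.mul_sum]
          rw [Finset.sum_comm]
          refine Finset.sum_eq_zero fun j _ => ?_
          have := congrFun hwM j
          simp only [Matrix.vecMul, dotProduct, Matrix.submatrix_apply, id, Pi.zero_apply] at this
          simp_rw [← mul_assoc, ← Finset.sum_mul, this, zero_mul]
        rw [Fin.sum_univ_succAbove _ k] at hsum
        simp only [hMv, mul_zero, Finset.sum_const_zero, add_zero] at hsum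
        exact (mul_eq_zero.1 hsum).resolve_left hk
      refine ⟨Fin.snoc v 0, fun h => hv ?_, fun i => ?_, fun j => ?_⟩
      · funext j
        simpa using congrFun h j.castSucc
      · rw [Fin.sum_univ_castSucc]
        simp only [Fin.snoc_castSucc, Fin.snoc_last, mul_zero, add_zero]
        rcases Fin.eq_self_or_eq_succAbove k i with rfl | ⟨i, rfl⟩
        · exact hkv
        · exact hMv i
      · rw [Fin.sum_univ_castSucc e]
        refine Fin.lastCases ?_ (fun j => ?_) j
        · simp
        · simpa using (hdeg j).trans (Nat.le_add_right _ _)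
    · refine ⟨fun j => (-1) ^ (j : ℕ) * (M.submatrix id j.succAbove).det, fun h => hdet ?_,
        fun i => ?_, fun j => ?_⟩
      · simpa [Fin.succAbove_last] using congrFun h (Fin.last _)
      · let B : Matrix (Fin (n + 2)) (Fin (n + 2)) (MvPolynomial σ R) := Matrix.of fun k j =>
          (Fin.cons (M i j) fun k => M k j : Fin (n + 2) → MvPolynomial σ R) k
        have h0 : B.det = 0 :=
          Matrix.det_zero_of_row_eq (Fin.succ_ne_zero i).symm (by funext j; simp [B])
        rw [Matrix.det_succ_row_zero] at h0
        rw [← h0]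
        refine Finset.sum_congr rfl fun j _ => ?_
        have hB : B.submatrix Fin.succ j.succAbove = M.submatrix id j.succAbove := by
          ext1
          simp [B]
        rw [hB]
        simp only [B, Matrix.of_apply, Fin.cons_zero]
        ring
      · rw [Fin.sum_univ_succAbove e j, add_comm]
        gcongr
        have hd := totalDegree_det_le (M.submatrix id j.succAbove) (fun i => e (j.succAbove i))
          fun i k => hM _ _
        rcases neg_one_pow_eq_or (MvPolynomial σ R) (j : ℕ) with h | h
        · simpa [h] using hd
        · simpa [h, totalDegree_neg] using hd

end MvPolynomial

namespace MvPowerSeries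

open MvPolynomial

section Reduction

variable {σ K : Type*} [CommRing K]

/-- Reduction of the powers of a root `f` of `∑ P i * X ^ i` to combinations of
`1, f, …, f ^ m`, with control of the degrees of the coefficients. -/
theorem exists_pow_reduction {m H : ℕ} {f : MvPowerSeries σ K}
    {P : Fin (m + 2) → MvPolynomial σ K} (hdeg : ∀ i, (P i).totalDegree ≤ H)
    (hrel : ∑ i, (P i : MvPowerSeries σ K) * f ^ (i : ℕ) = 0) (n : ℕ) :
    ∃ A : Fin (m + 1) → MvPolynomial σ K, (∀ i, (A i).totalDegree ≤ H * (n - m)) ∧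
      ((P (Fin.last _) ^ (n - m) : MvPolynomial σ K) : MvPowerSeries σ K) * f ^ n =
        ∑ i, (A i : MvPowerSeries σ K) * f ^ (i : ℕ) := by
  classical
  rcases le_total n m with hn | hn
  · refine ⟨Pi.single ⟨n, by omega⟩ 1, fun i => ?_, ?_⟩
    · by_cases h : i = ⟨n, by omega⟩
      · subst h; simp
      · simp [h]
    · rw [Finset.sum_eq_single ⟨n, by omega⟩]
      · simp [Nat.sub_eq_zero_of_le hn]
      · intro i _ h
        simp [h]
      · simp
  · induction n, hn using Nat.le_induction with
    | base =>
      refine ⟨Pi.single (Fin.last m) 1, fun i => ?_, ?_⟩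
      · by_cases h : i = Fin.last m
        · subst h; simp
        · simp [h]
      · rw [Finset.sum_eq_single (Fin.last m)]
        · simp
        · intro i _ h
          simp [h]
        · simp
    | succ n hn ih =>
      obtain ⟨A, hA, hAf⟩ := ih
      set L := P (Fin.last (m + 1))
      let S : Fin (m + 1) → MvPolynomial σ K := Fin.cons 0 fun i => L * A i.castSucc
      refine ⟨fun i => S i - A (Fin.last m) * P i.castSucc, fun i => ?_, ?_⟩
      · have hH : H * (n + 1 - m) = H + H * (n - m) := by
          rw [Nat.sub_add_comm hn]; ring
        refine (totalDegree_sub _ _).trans (max_le ?_ ?_)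
        · refine Fin.cases ?_ (fun i => ?_) i
          · simp [S]
          · simp only [S, Fin.cons_succ]
            rw [hH]
            exact (totalDegree_mul _ _).trans (add_le_add (hdeg _) (hA _))
        · rw [hH, add_comm H]
          exact (totalDegree_mul _ _).trans (add_le_add (hA _) (hdeg _))
      · have hS : ∑ i, (S i : MvPowerSeries σ K) * f ^ (i : ℕ) =
            L * f * ∑ i : Fin m, (A i.castSucc : MvPowerSeries σ K) * f ^ (i : ℕ) := by
          rw [Fin.sum_univ_succ, Finset.mul_sum]
          simp only [S, Fin.cons_zero, Fin.cons_succ, coe_zero, zero_mul, zero_add, coe_mul,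
            Fin.val_succ, pow_succ]
          exact Finset.sum_congr rfl fun i _ => by ring
        rw [Fin.sum_univ_castSucc] at hrel hAf
        simp only [Fin.val_castSucc, Fin.val_last] at hrel hAf
        rw [Nat.sub_add_comm hn, pow_succ, pow_succ]
        have hsub : ∀ a b : MvPolynomial σ K, ((a - b : MvPolynomial σ K) : MvPowerSeries σ K) =
            a - b := map_sub coeToMvPowerSeries.ringHom
        simp only [hsub, coe_mul, sub_mul, Finset.sum_sub_distrib, mul_assoc, ← Finset.mul_sum]
        rw [hS]
        push_cast at hAf hrel ⊢
        linear_combination (L : MvPowerSeries σ K) * f * hAf +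
          (A (Fin.last m) : MvPowerSeries σ K) * hrel

end Reduction

section Perfect

variable {σ K : Type*} [Field K] (p : ℕ) [ExpChar K p]

theorem coeff_nsmul_pow (hp : p ≠ 0) (g : MvPowerSeries σ K) (n : σ →₀ ℕ) :
    coeff (p • n) (g ^ p) = coeff n g ^ p := by
  rw [← map_frobenius_expand p hp, coeff_map, coeff_expand_smul, frobenius_def]

theorem coeff_pow_of_not_dvd (hp : p ≠ 0) (g : MvPowerSeries σ K) {n : σ →₀ ℕ} {i : σ}
    (h : ¬ p ∣ n i) : coeff n (g ^ p) = 0 := by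
  rw [← map_frobenius_expand p hp, coeff_map, coeff_expand_of_not_dvd p hp _ h, map_zero]

variable [PerfectRing K p]

/-- The Cartier operator: it extracts the coefficients at the exponents `p • n + r` and takes
their `p`-th roots. -/
noncomputable def cartier (r : σ →₀ ℕ) (g : MvPowerSeries σ K) : MvPowerSeries σ K :=
  fun n => (frobeniusEquiv K p).symm (coeff (p • n + r) g)

theorem coeff_cartier (r n : σ →₀ ℕ) (g : MvPowerSeries σ K) :
    coeff n (cartier p r g) = (frobeniusEquiv K p).symm (coeff (p • n + r) g) := rfl

theorem cartier_zero (r : σ →₀ ℕ) : cartier p r (0 : MvPowerSeries σ K) = 0 := by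
  ext n
  simp [coeff_cartier]

theorem cartier_sum {ι : Type*} (s : Finset ι) (r : σ →₀ ℕ) (g : ι → MvPowerSeries σ K) :
    cartier p r (∑ i ∈ s, g i) = ∑ i ∈ s, cartier p r (g i) := by
  ext n
  simp [coeff_cartier]

theorem cartier_mul_pow [Finite σ] {r : σ →₀ ℕ} (hr : ∀ i, r i < p) (R g : MvPowerSeries σ K) :
    cartier p r (R * g ^ p) = cartier p r R * g := by
  classical
  have hp : p ≠ 0 := expChar_ne_zero K p
  ext n
  rw [coeff_cartier, coeff_mul, coeff_mul, map_sum]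
  symm
  refine Finset.sum_of_injOn (fun x => (p • x.1 + r, p • x.2)) ?_ ?_ ?_ ?_
  · rintro ⟨a, b⟩ _ ⟨a', b'⟩ _ h
    simpa [nsmul_right_inj hp] using h
  · rintro ⟨a, b⟩ h
    have hab : a + b = n := Finset.HasAntidiagonal.mem_antidiagonal.1 h
    refine Finset.HasAntidiagonal.mem_antidiagonal.2 ?_
    change p • a + r + p • b = p • n + r
    rw [← hab, smul_add]
    abel
  · rintro ⟨a, b⟩ h hnot
    replace h : a + b = p • n + r := Finset.HasAntidiagonal.mem_antidiagonal.1 h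
    by_cases hb : ∀ i, p ∣ b i
    · refine absurd ?_ hnot
      choose c hc using hb
      have key : ∀ i, a i + p * c i = p * n i + r i := fun i => by
        simpa [hc] using DFunLike.congr_fun h i
      have hle : ∀ i, c i ≤ n i := fun i => by
        by_contra! hlt
        have := Nat.mul_le_mul_left p hlt
        have := key i
        have := hr i
        rw [Nat.mul_succ] at *
        omega
      refine ⟨(Finsupp.equivFunOnFinite.symm fun i => n i - c i, Finsupp.equivFunOnFinite.symm c),
        ?_, ?_⟩
      · refine Finset.HasAntidiagonal.mem_antidiagonal.2 ?_
        ext i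
        simp [hle i]
      · refine Prod.ext ?_ ?_
        · ext i
          have := key i
          have := Nat.mul_le_mul_left p (hle i)
          simp [Nat.mul_sub]
          omega
        · ext i
          simp [hc]
    · push Not at hb
      obtain ⟨i, hi⟩ := hb
      simp [coeff_pow_of_not_dvd p hp g hi]
  · rintro ⟨a, b⟩ _
    rw [coeff_cartier, coeff_nsmul_pow p hp, map_mul, frobeniusEquiv_symm_pow]

theorem exists_coe_eq_cartier (r : σ →₀ ℕ) (Q : MvPolynomial σ K) :
    ∃ Q' : MvPolynomial σ K, (Q' : MvPowerSeries σ K) = cartier p r Q ∧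
      Q'.totalDegree ≤ Q.totalDegree := by
  classical
  have hp : p ≠ 0 := expChar_ne_zero K p
  have hinj : Function.Injective fun n : σ →₀ ℕ => p • n + r := fun a b h => by
    simpa [nsmul_right_inj hp] using h
  let s := Q.support.preimage (fun n => p • n + r) hinj.injOn
  have hco : ∀ n, (truncFinset K s (cartier p r Q)).coeff n = coeff n (cartier p r Q) := fun n => by
    rw [coeff_truncFinset]
    split_ifs with h
    · rfl
    · have : MvPolynomial.coeff (p • n + r) Q = 0 := by simpa [s] using h
      rw [coeff_cartier, coeff_coe, this, map_zero]
  refine ⟨truncFinset K s (cartier p r Q), by ext n; rw [coeff_coe, hco], ?_⟩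
  refine Finset.sup_le fun n hn => ?_
  rw [MvPolynomial.mem_support_iff, hco, coeff_cartier, coeff_coe] at hn
  have hmem : p • n + r ∈ Q.support := by
    rw [MvPolynomial.mem_support_iff]
    intro h
    simp [h] at hn
  have := le_totalDegree hmem
  change n.degree ≤ _
  change (p • n + r).degree ≤ _ at this
  rw [map_add, map_nsmul, smul_eq_mul] at this
  have := Nat.le_mul_of_pos_left n.degree (Nat.pos_of_ne_zero hp)
  omega

/-- Extracting `p`-th roots from a polynomial relation between `p`-th powers. -/
theorem exists_relation_of_pow_relation [Finite σ] {ι : Type*} [Fintype ι] {D : ℕ}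
    {Q : ι → MvPolynomial σ K} {g : ι → MvPowerSeries σ K} (hQ : Q ≠ 0)
    (hdeg : ∀ i, (Q i).totalDegree ≤ D) (hrel : ∑ i, (Q i : MvPowerSeries σ K) * g i ^ p = 0) :
    ∃ Q' : ι → MvPolynomial σ K, Q' ≠ 0 ∧ (∀ i, (Q' i).totalDegree ≤ D) ∧
      ∑ i, (Q' i : MvPowerSeries σ K) * g i = 0 := by
  have hp : p ≠ 0 := expChar_ne_zero K p
  obtain ⟨j, hj⟩ := Function.ne_iff.1 hQ
  obtain ⟨m, hm⟩ := MvPolynomial.ne_zero_iff.1 hj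
  let r : σ →₀ ℕ := Finsupp.equivFunOnFinite.symm fun i => m i % p
  let q : σ →₀ ℕ := Finsupp.equivFunOnFinite.symm fun i => m i / p
  have hr : ∀ i, r i < p := fun i => Nat.mod_lt _ (Nat.pos_of_ne_zero hp)
  have hqr : p • q + r = m := by
    ext i
    simp [q, r, Nat.div_add_mod]
  choose Q' hQ' hdeg' using fun i => exists_coe_eq_cartier p r (Q i)
  refine ⟨Q', Function.ne_iff.2 ⟨j, fun h => hm ?_⟩, fun i => (hdeg' i).trans (hdeg i), ?_⟩
  · have h0 := congrArg (coeff q) (hQ' j)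
    rw [h, coeff_cartier, hqr, coeff_coe] at h0
    simpa using h0.symm
  · simp_rw [hQ', ← cartier_mul_pow p hr, ← cartier_sum, hrel, cartier_zero]

/-- A nontrivial relation between `f, f ^ p, …, f ^ p ^ s` can be made separable without
increasing the degrees of its coefficients. -/
theorem exists_relation_zero_ne [Finite σ] {D : ℕ} {f : MvPowerSeries σ K} :
    ∀ {s : ℕ} (Q : Fin (s + 1) → MvPolynomial σ K), Q ≠ 0 → (∀ i, (Q i).totalDegree ≤ D) →
      ∑ i, (Q i : MvPowerSeries σ K) * f ^ p ^ (i : ℕ) = 0 →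
      ∃ Q' : Fin (s + 1) → MvPolynomial σ K, (∀ i, (Q' i).totalDegree ≤ D) ∧ Q' 0 ≠ 0 ∧
        ∑ i, (Q' i : MvPowerSeries σ K) * f ^ p ^ (i : ℕ) = 0 := by
  intro s
  induction s with
  | zero =>
    intro Q hQ hdeg hrel
    refine ⟨Q, hdeg, fun h => hQ ?_, hrel⟩
    funext i
    rw [Fin.eq_zero i, h, Pi.zero_apply]
  | succ s ih =>
    intro Q hQ hdeg hrel
    by_cases h0 : Q 0 = 0
    · have htail : (fun i : Fin (s + 1) => Q i.succ) ≠ 0 := fun h => hQ <| by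
        funext i
        exact Fin.cases h0 (fun i => congrFun h i) i
      rw [Fin.sum_univ_succ, h0] at hrel
      simp only [coe_zero, zero_mul, zero_add, Fin.val_succ, pow_succ, pow_mul] at hrel
      obtain ⟨R, hR, hRdeg, hRrel⟩ :=
        exists_relation_of_pow_relation p htail (fun i => hdeg i.succ) hrel
      obtain ⟨T, hTdeg, hT0, hTrel⟩ := ih R hR hRdeg hRrel
      refine ⟨Fin.snoc T 0, fun i => ?_, ?_, ?_⟩
      · refine Fin.lastCases ?_ (fun i => ?_) i
        · simp
        · simpa using hTdeg i
      · rw [← Fin.castSucc_zero, Fin.snoc_castSucc]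
        exact hT0
      · rw [Fin.sum_univ_castSucc]
        simpa using hTrel
    · exact ⟨Q, hdeg, h0, hrel⟩

end Perfect

/-- A root of a polynomial of degree `m + 1` and height at most `H` satisfies a nontrivial
`p`-linear relation of controlled height. -/
theorem exists_linearized_relation {σ K : Type*} [CommRing K] [IsDomain K] {p m H : ℕ}
    (hp : 0 < p) {f : MvPowerSeries σ K} {P : Fin (m + 2) → MvPolynomial σ K}
    (hdeg : ∀ i, (P i).totalDegree ≤ H) (hlead : P (Fin.last _) ≠ 0)
    (hrel : ∑ i, (P i : MvPowerSeries σ K) * f ^ (i : ℕ) = 0) :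
    ∃ Q : Fin (m + 2) → MvPolynomial σ K, Q ≠ 0 ∧
      (∀ i, (Q i).totalDegree ≤ H * (m + 1) * p ^ (m + 1)) ∧
      ∑ i, (Q i : MvPowerSeries σ K) * f ^ p ^ (i : ℕ) = 0 := by
  choose A hA hAf using exists_pow_reduction hdeg hrel
  set L := P (Fin.last (m + 1))
  let e : Fin (m + 2) → ℕ := fun k => H * (p ^ (k : ℕ) - 1 - m)
  obtain ⟨v, hv, hMv, hvdeg⟩ := exists_mulVec_eq_zero_totalDegree_le (m + 1)
    (Matrix.of fun i k => A (p ^ (k : ℕ) - 1) i) e fun i k => hA _ _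
  have he : ∑ k, e k ≤ H * (m + 1) * p ^ (m + 1) := by
    have h0 : e 0 = 0 := by simp [e]
    rw [Fin.sum_univ_succ, h0, zero_add]
    refine (Finset.sum_le_card_nsmul _ _ (H * p ^ (m + 1)) fun k _ => ?_).trans ?_
    · refine Nat.mul_le_mul_left H ((Nat.sub_le _ _).trans ((Nat.sub_le _ _).trans ?_))
      exact Nat.pow_le_pow_right hp (by simp; omega)
    · simp only [Finset.card_univ, Fintype.card_fin, smul_eq_mul]
      exact le_of_eq (by ring)
  refine ⟨fun k => v k * L ^ (p ^ (k : ℕ) - 1 - m), fun h => hv ?_, fun k => ?_, ?_⟩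
  · funext k
    exact (mul_eq_zero.1 (congrFun h k)).resolve_right (pow_ne_zero _ hlead)
  · refine (totalDegree_mul _ _).trans (le_trans ?_ ((hvdeg k).trans he))
    gcongr
    refine (totalDegree_pow _ _).trans ?_
    rw [mul_comm]
    exact Nat.mul_le_mul_right _ (hdeg _)
  · have hf : ∀ k : Fin (m + 2), f ^ p ^ (k : ℕ) = f ^ (p ^ (k : ℕ) - 1) * f := fun k => by
      rw [← pow_succ, Nat.sub_add_cancel (Nat.pow_pos hp)]
    simp_rw [coe_mul, hf, ← mul_assoc, ← Finset.sum_mul]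
    convert zero_mul f
    simp_rw [mul_assoc, hAf, Finset.mul_sum]
    rw [Finset.sum_comm]
    refine Finset.sum_eq_zero fun i _ => ?_
    have h := congrArg (fun q : MvPolynomial σ K => (q : MvPowerSeries σ K)) (hMv i)
    simp only [Matrix.of_apply, coe_zero] at h
    rw [← coeToMvPowerSeries.ringHom_apply, map_sum] at h
    simp only [map_mul, coeToMvPowerSeries.ringHom_apply] at h
    rw [← zero_mul (f ^ (i : ℕ)), ← h, Finset.sum_mul]
    exact Finset.sum_congr rfl fun k _ => by ring

end MvPowerSeries


/-- effective Ore's lemma: if `f` is a multivariate power series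
over a perfect field of characteristic `p`, algebraic of degree at most `s` and
height at most `H`, then there are polynomials `Q_0,…,Q_s` of total degree at
most `H·s·p^s` with `Σ Q_i f^{p^i} = 0` and `Q_0 ≠ 0`. -/
theorem effective_ore_lemma
    (p : ℕ) (hp : p.Prime) (K : Type*) [Field K] [CharP K p]
    (hperf : Function.Surjective fun x : K => x ^ p)
    (d : ℕ) (hd : 0 < d)
    (s H : ℕ) (hs : 0 < s) (hH : 0 < H)
    (f : MvPowerSeries (Fin d) K)
    (P : Fin (s + 1) → MvPolynomial (Fin d) K)
    (hdeg : ∀ i, (P i).totalDegree ≤ H)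
    (hlead : P (Fin.last s) ≠ 0)
    (hrel : ∑ i : Fin (s + 1), (P i : MvPowerSeries (Fin d) K) * f ^ (i : ℕ) = 0) :
    ∃ Q : Fin (s + 1) → MvPolynomial (Fin d) K,
      (∀ i, (Q i).totalDegree ≤ H * s * p ^ s) ∧ Q 0 ≠ 0 ∧
      ∑ i : Fin (s + 1), (Q i : MvPowerSeries (Fin d) K) * f ^ (p ^ (i : ℕ)) = 0 := by
  obtain ⟨m, rfl⟩ := Nat.exists_eq_add_of_le' hs
  have : Fact p.Prime := ⟨hp⟩
  have : PerfectRing K p := PerfectRing.ofSurjective K p hperf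
  obtain ⟨Q, hQ, hQdeg, hQrel⟩ :=
    MvPowerSeries.exists_linearized_relation hp.pos hdeg hlead hrel
  exact MvPowerSeries.exists_relation_zero_ne p Q hQ hQdeg hQrel
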